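/- Let γ < 0 and assume (A.1) and (A.2). Then for each δ ∈ (0, 1/d) there exist a bounded continuous function v_δ : S → ℝ and a constant λ_δ ∈ ℝ, with v_δ unique up to an additive constant, such that for every π ∈ S: v_δ(π) + λ_δ = (T_δ v_δ)(π) = sup_{π' ∈ S_δ} [ γ ln s(π, π') + ln E[ exp( γ ln⟨π', w⟩ + v_δ(G(π', w)) ) ] ]. -/

import Mathlib

open MeasureTheory Set

noncomputable section

/-- Standard scalar product on `ℝ^d`. -/
def ip {d : ℕ} (x y : Fin d → ℝ) : ℝ := ∑ i, x i * y i

/-- `G(x,y) = (x·y)/⟨x,y⟩` (componentwise product, normalised). -/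
def Gmap {d : ℕ} (x y : Fin d → ℝ) : Fin d → ℝ := fun i => x i * y i / ip x y

/-- `S_δ`, the set of allocations in the simplex with all weights at least `δ`. -/
def Sdel {d : ℕ} (δ : ℝ) : Set (Fin d → ℝ) := {π ∈ stdSimplex ℝ (Fin d) | ∀ i, δ ≤ π i}

/-- The restricted Bellman operator
`(T_δ v)(π) = sup_{π' ∈ S_δ} [γ ln s(π,π') + ln E[exp(γ ln⟨π',w⟩ + v(G(π',w)))]]`. -/
def Tdel {d : ℕ} {Ω : Type*} [MeasurableSpace Ω] (P : Measure Ω) (γ : ℝ)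
    (s : (Fin d → ℝ) → (Fin d → ℝ) → ℝ) (r : Ω → Fin d → ℝ) (δ : ℝ)
    (v : (Fin d → ℝ) → ℝ) (π : Fin d → ℝ) : ℝ :=
  sSup ((fun π' => γ * Real.log (s π π') +
      Real.log (∫ ω, Real.exp (γ * Real.log (ip π' (fun i => Real.exp (r ω i))) +
        v (Gmap π' (fun i => Real.exp (r ω i)))) ∂P)) '' Sdel δ)

/-- Span seminorm `‖v‖_sp = sup_{π,π' ∈ S} (v(π) − v(π'))/2`. -/
def spanSemi {d : ℕ} (f : (Fin d → ℝ) → ℝ) : ℝ :=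
  sSup {y | ∃ π ∈ stdSimplex ℝ (Fin d), ∃ π' ∈ stdSimplex ℝ (Fin d), y = (f π - f π') / 2}

/-- A strictly positive integrable weight has uniformly positive mass on sets of probability
at least `η`. -/
lemma exists_pos_le_setIntegral_exp {Ω : Type*} [MeasurableSpace Ω] (P : Measure Ω)
    [IsProbabilityMeasure P] {f : Ω → ℝ} (hf : Measurable f)
    (hfi : Integrable (fun ω => Real.exp (f ω)) P) {η : ℝ} (hη : 0 < η) :
    ∃ c > 0, ∀ B : Set Ω, MeasurableSet B → η ≤ P.real B → c ≤ ∫ ω in B, Real.exp (f ω) ∂P := by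
  have hlim : Filter.Tendsto (fun n : ℕ => P.real {ω | f ω < -(n : ℝ)}) Filter.atTop
      (nhds 0) := by
    have h := tendsto_measure_iInter_atTop (μ := P) (s := fun n : ℕ => {ω | f ω < -(n : ℝ)})
      (fun n => (measurableSet_lt hf measurable_const).nullMeasurableSet)
      (fun m n hmn ω hω => by
        have : (m : ℝ) ≤ n := by exact_mod_cast hmn
        simp only [mem_ofPred_eq] at hω ⊢
        linarith)
      ⟨0, measure_ne_top _ _⟩
    have he : ⋂ n : ℕ, {ω | f ω < -(n : ℝ)} = ∅ := by
      ext ω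
      simp only [mem_iInter, mem_ofPred_eq, mem_empty_iff_false, iff_false, not_forall, not_lt]
      obtain ⟨n, hn⟩ := exists_nat_ge (-f ω)
      exact ⟨n, by linarith⟩
    rw [he, measure_empty] at h
    exact (ENNReal.tendsto_toReal ENNReal.zero_ne_top).comp h
  obtain ⟨n, hn⟩ := (hlim.eventually (gt_mem_nhds (half_pos hη))).exists
  refine ⟨Real.exp (-(n : ℝ)) * (η / 2), by positivity, fun B hB hPB => ?_⟩
  have hS : MeasurableSet {ω | f ω < -(n : ℝ)} := measurableSet_lt hf measurable_const
  have hdiff : η / 2 ≤ P.real (B \ {ω | f ω < -(n : ℝ)}) := by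
    have := le_measureReal_sdiff (μ := P) (s₁ := B) (s₂ := {ω | f ω < -(n : ℝ)})
    linarith
  calc Real.exp (-(n : ℝ)) * (η / 2)
      ≤ Real.exp (-(n : ℝ)) * P.real (B \ {ω | f ω < -(n : ℝ)}) := by gcongr
    _ = ∫ ω in B \ {ω | f ω < -(n : ℝ)}, Real.exp (-(n : ℝ)) ∂P := by
        rw [setIntegral_const, smul_eq_mul, mul_comm]
    _ ≤ ∫ ω in B \ {ω | f ω < -(n : ℝ)}, Real.exp (f ω) ∂P := by
        refine setIntegral_mono_on (integrable_const _) hfi.integrableOn (hB.diff hS) ?_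
        intro ω hω
        have : ¬ f ω < -(n : ℝ) := hω.2
        exact Real.exp_le_exp.2 (not_lt.1 this)
    _ ≤ ∫ ω in B, Real.exp (f ω) ∂P :=
        setIntegral_mono_set hfi.integrableOn
          (Filter.Eventually.of_forall fun ω => (Real.exp_pos _).le)
          (Filter.Eventually.of_forall fun ω hω => hω.1)

section ExpWeight

variable {Ω X : Type*} [MeasurableSpace Ω] {P : Measure Ω}
  [TopologicalSpace X] [CompactSpace X] [MeasurableSpace X] [BorelSpace X]

lemma integrable_exp_add_comp {g hi : Ω → ℝ} {G : Ω → X} (hg : Measurable g)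
    (hG : Measurable G) (hghi : ∀ ω, g ω ≤ hi ω)
    (hhi : Integrable (fun ω => Real.exp (hi ω)) P) (v : C(X, ℝ)) :
    Integrable (fun ω => Real.exp (g ω + v (G ω))) P := by
  refine (hhi.mul_const (Real.exp ‖v‖)).mono' ?_ ?_
  · exact (hg.add (v.continuous.measurable.comp hG)).exp.aestronglyMeasurable
  · refine Filter.Eventually.of_forall fun ω => ?_
    rw [Real.norm_eq_abs, abs_of_pos (Real.exp_pos _), ← Real.exp_add]
    exact Real.exp_le_exp.2 (add_le_add (hghi ω) ((le_abs_self _).trans (v.norm_coe_le_norm _)))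

variable [IsProbabilityMeasure P]

lemma log_integral_exp_le {g hi : Ω → ℝ} {G : Ω → X} (hg : Measurable g)
    (hG : Measurable G) (hghi : ∀ ω, g ω ≤ hi ω)
    (hhi : Integrable (fun ω => Real.exp (hi ω)) P) {v₁ v₂ : C(X, ℝ)} {M : ℝ}
    (h : ∀ x, v₁ x ≤ v₂ x + M) :
    Real.log (∫ ω, Real.exp (g ω + v₁ (G ω)) ∂P) ≤
      Real.log (∫ ω, Real.exp (g ω + v₂ (G ω)) ∂P) + M := by
  have i1 := integrable_exp_add_comp hg hG hghi hhi v₁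
  have i2 := integrable_exp_add_comp hg hG hghi hhi v₂
  have hI1 := integral_exp_pos i1
  have hI2 := integral_exp_pos i2
  rw [← Real.log_exp M, ← Real.log_mul hI2.ne' (Real.exp_pos _).ne']
  refine Real.log_le_log hI1 ?_
  rw [← integral_mul_const]
  refine integral_mono i1 (i2.mul_const _) fun ω => ?_
  simp only [← Real.exp_add]
  exact Real.exp_le_exp.2 (by linarith [h (G ω)])

/-- If `v₁ ≤ v₂ + M` with a gain `h` on an event `B` of non-negligible weight, then the
log-exponential functional gains a fixed proportion of `h`. -/
lemma log_integral_exp_le_sub [Nonempty X] {lo g hi : Ω → ℝ} {G : Ω → X} (hlom : Measurable lo)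
    (hg : Measurable g)
    (hG : Measurable G) (hlog : ∀ ω, lo ω ≤ g ω) (hghi : ∀ ω, g ω ≤ hi ω)
    (hhi : Integrable (fun ω => Real.exp (hi ω)) P) {v₁ v₂ : C(X, ℝ)} {M h L c : ℝ}
    (hv : ∀ x, v₁ x ≤ v₂ x + M) (hL : ∀ x y, v₂ x - v₂ y ≤ L) {B : Set Ω} (hB : MeasurableSet B)
    (hvB : ∀ ω ∈ B, v₁ (G ω) ≤ v₂ (G ω) + M - h) (h0 : 0 ≤ h) (hhL : h ≤ L) (hc : 0 < c)
    (hcB : c ≤ ∫ ω in B, Real.exp (lo ω) ∂P) :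
    Real.log (∫ ω, Real.exp (g ω + v₁ (G ω)) ∂P) ≤
      Real.log (∫ ω, Real.exp (g ω + v₂ (G ω)) ∂P) + M -
        (c / (∫ ω, Real.exp (hi ω) ∂P) * Real.exp (-L) * Real.exp (-L)) * h := by
  have i1 := integrable_exp_add_comp hg hG hghi hhi v₁
  have i2 := integrable_exp_add_comp hg hG hghi hhi v₂
  have ilo : Integrable (fun ω => Real.exp (lo ω)) P := by
    refine hhi.mono' hlom.exp.aestronglyMeasurable (Filter.Eventually.of_forall fun ω => ?_)
    rw [Real.norm_eq_abs, abs_of_pos (Real.exp_pos _)]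
    exact Real.exp_le_exp.2 ((hlog ω).trans (hghi ω))
  have hI1 := integral_exp_pos i1
  have hI2 := integral_exp_pos i2
  have hW := integral_exp_pos hhi
  obtain ⟨x₀, -, hx₀⟩ := isCompact_univ.exists_isMinOn univ_nonempty v₂.continuous.continuousOn
  have hmin : ∀ x, v₂ x₀ ≤ v₂ x := fun x => hx₀ (mem_univ x)
  set I₁ := ∫ ω, Real.exp (g ω + v₁ (G ω)) ∂P
  set I₂ := ∫ ω, Real.exp (g ω + v₂ (G ω)) ∂P
  set W := ∫ ω, Real.exp (hi ω) ∂P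
  set J := ∫ ω in B, Real.exp (g ω + v₂ (G ω)) ∂P
  have hJ : Real.exp (v₂ x₀) * c ≤ J := by
    calc Real.exp (v₂ x₀) * c ≤ Real.exp (v₂ x₀) * ∫ ω in B, Real.exp (lo ω) ∂P := by gcongr
      _ = ∫ ω in B, Real.exp (v₂ x₀) * Real.exp (lo ω) ∂P := by rw [integral_const_mul]
      _ ≤ J := by
        refine setIntegral_mono (ilo.const_mul _).integrableOn i2.integrableOn fun ω => ?_
        simp only [← Real.exp_add]
        exact Real.exp_le_exp.2 (by linarith [hmin (G ω), hlog ω])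
  have hI2W : I₂ ≤ Real.exp (v₂ x₀ + L) * W := by
    rw [← integral_const_mul]
    refine integral_mono i2 (hhi.const_mul _) fun ω => ?_
    simp only [← Real.exp_add]
    exact Real.exp_le_exp.2 (by linarith [hL (G ω) x₀, hghi ω])
  have hρ : c / W * Real.exp (-L) * I₂ ≤ J := by
    calc c / W * Real.exp (-L) * I₂
        ≤ c / W * Real.exp (-L) * (Real.exp (v₂ x₀ + L) * W) := by gcongr
      _ = Real.exp (v₂ x₀) * c := by
        rw [Real.exp_add, Real.exp_neg]
        field_simp
      _ ≤ J := hJ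
  have hstep : I₁ ≤ Real.exp M * (I₂ - (1 - Real.exp (-h)) * J) := by
    have hJi : J = ∫ ω, B.indicator (fun ω => Real.exp (g ω + v₂ (G ω))) ω ∂P :=
      (integral_indicator hB).symm
    have i3 := i2.indicator hB
    rw [hJi, ← integral_const_mul, ← integral_sub i2 (i3.const_mul _), ← integral_const_mul]
    refine integral_mono i1 ((i2.sub (i3.const_mul _)).const_mul _) fun ω => ?_
    by_cases hω : ω ∈ B
    · simp only [indicator_of_mem hω]
      have : Real.exp M * (Real.exp (g ω + v₂ (G ω)) -
          (1 - Real.exp (-h)) * Real.exp (g ω + v₂ (G ω))) =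
          Real.exp (g ω + v₂ (G ω) + M - h) := by
        rw [show g ω + v₂ (G ω) + M - h = M + (-h) + (g ω + v₂ (G ω)) by ring,
          Real.exp_add (M + -h), Real.exp_add M]
        ring
      rw [this]
      exact Real.exp_le_exp.2 (by linarith [hvB ω hω])
    · simp only [indicator_of_notMem hω, mul_zero, sub_zero, ← Real.exp_add]
      exact Real.exp_le_exp.2 (by linarith [hv (G ω)])
  have hh : Real.exp (-L) * h ≤ 1 - Real.exp (-h) := by
    have e1 : Real.exp (-L) ≤ Real.exp (-h) := Real.exp_le_exp.2 (by linarith)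
    have e2 : h + 1 ≤ Real.exp h := Real.add_one_le_exp h
    have e3 : Real.exp (-h) * Real.exp h = 1 := by rw [← Real.exp_add]; simp
    nlinarith [Real.exp_pos (-h)]
  set β := c / W * Real.exp (-L) * Real.exp (-L) * h
  have hβ : β * I₂ ≤ (1 - Real.exp (-h)) * J := by
    calc β * I₂ = (Real.exp (-L) * h) * (c / W * Real.exp (-L) * I₂) := by ring
      _ ≤ (1 - Real.exp (-h)) * J := by
        apply mul_le_mul hh hρ (by positivity)
        exact (by positivity : (0 : ℝ) ≤ Real.exp (-L) * h).trans hh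
  have hfin : I₁ ≤ I₂ * Real.exp (M - β) := by
    calc I₁ ≤ Real.exp M * (I₂ - (1 - Real.exp (-h)) * J) := hstep
      _ ≤ Real.exp M * (I₂ - β * I₂) := by gcongr
      _ = Real.exp M * I₂ * (-β + 1) := by ring
      _ ≤ Real.exp M * I₂ * Real.exp (-β) := by gcongr; exact Real.add_one_le_exp _
      _ = I₂ * Real.exp (M - β) := by rw [sub_eq_add_neg, Real.exp_add]; ring
  calc Real.log I₁ ≤ Real.log (I₂ * Real.exp (M - β)) := Real.log_le_log hI1 hfin
    _ = Real.log I₂ + M - β := by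
      rw [Real.log_mul hI2.ne' (Real.exp_pos _).ne', Real.log_exp]; ring

end ExpWeight

section Bellman

variable {Ω X K : Type*} [MeasurableSpace Ω] {P : Measure Ω}
  [TopologicalSpace X] [MeasurableSpace X]

/-- The risk-sensitive certainty equivalent of `v` under the action `k`. -/
def certEquiv (P : Measure Ω) (g : K → Ω → ℝ) (G : K → Ω → X) (v : C(X, ℝ)) (k : K) : ℝ :=
  Real.log (∫ ω, Real.exp (g k ω + v (G k ω)) ∂P)

/-- The Bellman operator with running cost `c` and certainty equivalent `certEquiv`. -/
def bellman (P : Measure Ω) (c : X → K → ℝ) (g : K → Ω → ℝ) (G : K → Ω → X) (v : C(X, ℝ))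
    (x : X) : ℝ :=
  ⨆ k, (c x k + certEquiv P g G v k)

variable [IsProbabilityMeasure P] [CompactSpace X] [BorelSpace X]
  {c : X → K → ℝ} {g : K → Ω → ℝ} {G : K → Ω → X} {lo hi : Ω → ℝ} {L : ℝ}

lemma bddAbove_bellman (hc : ∀ x k, c x k ∈ Icc 0 L) (hg : ∀ k, Measurable (g k))
    (hG : ∀ k, Measurable (G k)) (hghi : ∀ k ω, g k ω ≤ hi ω)
    (hhi : Integrable (fun ω => Real.exp (hi ω)) P) (v : C(X, ℝ)) (x : X) :
    BddAbove (range fun k => c x k + certEquiv P g G v k) := by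
  refine ⟨L + (Real.log (∫ ω, Real.exp (hi ω) ∂P) + ‖v‖), ?_⟩
  rintro _ ⟨k, rfl⟩
  refine add_le_add (hc x k).2 ?_
  have h1 := log_integral_exp_le (hg k) (hG k) (hghi k) hhi (v₁ := v) (v₂ := 0) (M := ‖v‖)
    (fun x => by simpa using (le_abs_self _).trans (v.norm_coe_le_norm x))
  refine h1.trans (add_le_add ?_ le_rfl)
  have i0 := integrable_exp_add_comp (hg k) (hG k) (hghi k) hhi (0 : C(X, ℝ))
  refine Real.log_le_log (integral_exp_pos i0) (integral_mono i0 hhi fun ω => ?_)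
  simpa using hghi k ω

variable [Nonempty K]

lemma bellman_le_of_le_add (hc : ∀ x k, c x k ∈ Icc 0 L) (hg : ∀ k, Measurable (g k))
    (hG : ∀ k, Measurable (G k)) (hghi : ∀ k ω, g k ω ≤ hi ω)
    (hhi : Integrable (fun ω => Real.exp (hi ω)) P) {v₁ v₂ : C(X, ℝ)} {M : ℝ}
    (h : ∀ x, v₁ x ≤ v₂ x + M) (x : X) :
    bellman P c g G v₁ x ≤ bellman P c g G v₂ x + M := by
  refine ciSup_le fun k => ?_
  have h1 : certEquiv P g G v₁ k ≤ certEquiv P g G v₂ k + M :=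
    log_integral_exp_le (hg k) (hG k) (hghi k) hhi h
  have h2 : c x k + certEquiv P g G v₂ k ≤ bellman P c g G v₂ x :=
    le_ciSup (bddAbove_bellman hc hg hG hghi hhi v₂ x) k
  linarith

lemma bellman_le_add_of_cost_le (hc : ∀ x k, c x k ∈ Icc 0 L) (hg : ∀ k, Measurable (g k))
    (hG : ∀ k, Measurable (G k)) (hghi : ∀ k ω, g k ω ≤ hi ω)
    (hhi : Integrable (fun ω => Real.exp (hi ω)) P) (v : C(X, ℝ)) {x y : X} {ε : ℝ}
    (h : ∀ k, c x k ≤ c y k + ε) :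
    bellman P c g G v x ≤ bellman P c g G v y + ε := by
  refine ciSup_le fun k => ?_
  have h2 : c y k + certEquiv P g G v k ≤ bellman P c g G v y :=
    le_ciSup (bddAbove_bellman hc hg hG hghi hhi v y) k
  linarith [h k]

lemma continuous_bellman (hc : ∀ x k, c x k ∈ Icc 0 L)
    (hcc : ∀ x, ∀ ε > 0, ∀ᶠ y in nhds x, ∀ k, |c y k - c x k| < ε)
    (hg : ∀ k, Measurable (g k))
    (hG : ∀ k, Measurable (G k)) (hghi : ∀ k ω, g k ω ≤ hi ω)
    (hhi : Integrable (fun ω => Real.exp (hi ω)) P) (v : C(X, ℝ)) :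
    Continuous (bellman P c g G v) := by
  rw [continuous_iff_continuousAt]
  intro x
  refine Metric.tendsto_nhds.2 fun ε hε => ?_
  filter_upwards [hcc x (ε / 2) (half_pos hε)] with y hy
  rw [Real.dist_eq, abs_lt]
  have h1 := bellman_le_add_of_cost_le hc hg hG hghi hhi v (x := y) (y := x) (ε := ε / 2)
    fun k => by linarith [(abs_lt.1 (hy k)).2]
  have h2 := bellman_le_add_of_cost_le hc hg hG hghi hhi v (x := x) (y := y) (ε := ε / 2)
    fun k => by linarith [(abs_lt.1 (hy k)).1]
  constructor <;> linarith

variable [Nonempty X]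

/-- Under a mixing condition, the Bellman operator contracts the oscillation on functions of
oscillation at most `L`. -/
lemma exists_bellman_contraction (hc : ∀ x k, c x k ∈ Icc 0 L)
    (hlo : Measurable lo) (hg : ∀ k, Measurable (g k))
    (hG : ∀ k, Measurable (G k)) (hlog : ∀ k ω, lo ω ≤ g k ω) (hghi : ∀ k ω, g k ω ≤ hi ω)
    (hhi : Integrable (fun ω => Real.exp (hi ω)) P)
    (hmix : ∃ κ < (1 : ℝ), ∀ A : Set X, MeasurableSet A → ∀ k k',
      P.real (G k ⁻¹' A) - P.real (G k' ⁻¹' A) ≤ κ) :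
    ∃ q : ℝ, 0 ≤ q ∧ q < 1 ∧ ∀ v₁ v₂ : C(X, ℝ), (∀ x y, v₁ x - v₁ y ≤ L) →
      (∀ x y, v₂ x - v₂ y ≤ L) → ∀ D, (∀ x y, (v₁ x - v₂ x) - (v₁ y - v₂ y) ≤ D) → ∀ x y,
        (bellman P c g G v₁ x - bellman P c g G v₂ x) -
          (bellman P c g G v₁ y - bellman P c g G v₂ y) ≤ q * D := by
  obtain ⟨κ, hκ, hmix⟩ := hmix
  have k₀ : K := Classical.arbitrary K
  have ilo : Integrable (fun ω => Real.exp (lo ω)) P := by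
    refine hhi.mono' hlo.exp.aestronglyMeasurable (Filter.Eventually.of_forall fun ω => ?_)
    rw [Real.norm_eq_abs, abs_of_pos (Real.exp_pos _)]
    exact Real.exp_le_exp.2 ((hlog k₀ ω).trans (hghi k₀ ω))
  obtain ⟨a, ha, haB⟩ := exists_pos_le_setIntegral_exp P hlo ilo
    (show 0 < (1 - κ) / 2 by linarith)
  have hW := integral_exp_pos hhi
  set β := a / (∫ ω, Real.exp (hi ω) ∂P) * Real.exp (-L) * Real.exp (-L) with hβ
  have hβ0 : 0 < β := by positivity
  refine ⟨max 0 (1 - β / 2), le_max_left _ _, max_lt one_pos (by linarith), ?_⟩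
  intro v₁ v₂ h₁ h₂ D hD x y
  obtain ⟨xM, -, hxM⟩ := isCompact_univ.exists_isMaxOn univ_nonempty
    (v₁ - v₂).continuous.continuousOn
  obtain ⟨xm, -, hxm⟩ := isCompact_univ.exists_isMinOn univ_nonempty
    (v₁ - v₂).continuous.continuousOn
  have hM : ∀ z, v₁ z - v₂ z ≤ v₁ xM - v₂ xM := fun z => hxM (mem_univ z)
  have hm : ∀ z, v₁ xm - v₂ xm ≤ v₁ z - v₂ z := fun z => hxm (mem_univ z)
  have hMm := hD xM xm
  set M := v₁ xM - v₂ xM with hMdef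
  set m := v₁ xm - v₂ xm with hmdef
  have hmM : m ≤ M := hm xM
  have hL2 : M - m ≤ 2 * L := by linarith [h₁ xM xm, h₂ xm xM]
  have hpair : ∀ k k', (certEquiv P g G v₁ k - certEquiv P g G v₂ k) +
      (certEquiv P g G v₂ k' - certEquiv P g G v₁ k') ≤ M - m - β * ((M - m) / 2) := by
    intro k k'
    set A : Set X := {z | (M + m) / 2 ≤ v₁ z - v₂ z} with hA
    have hAm : MeasurableSet A :=
      (isClosed_le continuous_const (v₁ - v₂).continuous).measurableSet
    have t1 : certEquiv P g G v₁ k ≤ certEquiv P g G v₂ k + M :=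
      log_integral_exp_le (hg k) (hG k) (hghi k) hhi fun z => by linarith [hM z]
    have t2 : certEquiv P g G v₂ k' ≤ certEquiv P g G v₁ k' + -m :=
      log_integral_exp_le (hg k') (hG k') (hghi k') hhi fun z => by linarith [hm z]
    have hkk := hmix A hAm k k'
    have hcompl : P.real (G k ⁻¹' A)ᶜ = 1 - P.real (G k ⁻¹' A) :=
      probReal_compl_eq_one_sub (hG k hAm)
    by_cases hcase : (1 - κ) / 2 ≤ P.real (G k ⁻¹' A)ᶜ
    · have := log_integral_exp_le_sub hlo (hg k) (hG k) (hlog k) (hghi k) hhi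
        (v₁ := v₁) (v₂ := v₂) (M := M) (h := (M - m) / 2) (L := L) (c := a)
        (fun z => by linarith [hM z]) h₂ (hG k hAm).compl
        (fun ω hω => by
          have : ¬ (M + m) / 2 ≤ v₁ (G k ω) - v₂ (G k ω) := hω
          linarith)
        (by linarith) (by linarith) ha (haB _ (hG k hAm).compl hcase)
      change certEquiv P g G v₁ k ≤ certEquiv P g G v₂ k + M - β * ((M - m) / 2) at this
      linarith
    · have := log_integral_exp_le_sub hlo (hg k') (hG k') (hlog k') (hghi k') hhi
        (v₁ := v₂) (v₂ := v₁) (M := -m) (h := (M - m) / 2) (L := L) (c := a)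
        (fun z => by linarith [hm z]) h₁ (hG k' hAm)
        (fun ω hω => by
          have : (M + m) / 2 ≤ v₁ (G k' ω) - v₂ (G k' ω) := hω
          linarith)
        (by linarith) (by linarith) ha (haB _ (hG k' hAm) (by linarith))
      change certEquiv P g G v₂ k' ≤ certEquiv P g G v₁ k' + -m - β * ((M - m) / 2) at this
      linarith
  have hsum : bellman P c g G v₁ x + bellman P c g G v₂ y ≤
      bellman P c g G v₂ x + bellman P c g G v₁ y + (M - m - β * ((M - m) / 2)) := by
    have s1 : ∀ k', bellman P c g G v₁ x ≤ bellman P c g G v₂ x + bellman P c g G v₁ y +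
        (M - m - β * ((M - m) / 2)) - (c y k' + certEquiv P g G v₂ k') := by
      intro k'
      refine ciSup_le fun k => ?_
      have b1 : c x k + certEquiv P g G v₂ k ≤ bellman P c g G v₂ x :=
        le_ciSup (bddAbove_bellman hc hg hG hghi hhi v₂ x) k
      have b2 : c y k' + certEquiv P g G v₁ k' ≤ bellman P c g G v₁ y :=
        le_ciSup (bddAbove_bellman hc hg hG hghi hhi v₁ y) k'
      linarith [hpair k k']
    have s2 : bellman P c g G v₂ y ≤ bellman P c g G v₂ x + bellman P c g G v₁ y +
        (M - m - β * ((M - m) / 2)) - bellman P c g G v₁ x :=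
      ciSup_le fun k' => by linarith [s1 k']
    linarith
  calc _ ≤ (1 - β / 2) * (M - m) := by linarith
    _ ≤ max 0 (1 - β / 2) * (M - m) :=
      mul_le_mul_of_nonneg_right (le_max_right _ _) (by linarith)
    _ ≤ max 0 (1 - β / 2) * D := mul_le_mul_of_nonneg_left hMm (le_max_left _ _)

/-- Solvability of the risk-sensitive Bellman equation, with uniqueness up to constants. -/
theorem bellman_solution_exists_unique (hc : ∀ x k, c x k ∈ Icc 0 L)
    (hcc : ∀ x, ∀ ε > 0, ∀ᶠ y in nhds x, ∀ k, |c y k - c x k| < ε)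
    (hlo : Measurable lo) (hg : ∀ k, Measurable (g k))
    (hG : ∀ k, Measurable (G k)) (hlog : ∀ k ω, lo ω ≤ g k ω) (hghi : ∀ k ω, g k ω ≤ hi ω)
    (hhi : Integrable (fun ω => Real.exp (hi ω)) P)
    (hmix : ∃ κ < (1 : ℝ), ∀ A : Set X, MeasurableSet A → ∀ k k',
      P.real (G k ⁻¹' A) - P.real (G k' ⁻¹' A) ≤ κ) :
    ∃ (v : C(X, ℝ)) (lam : ℝ), (∀ x, v x + lam = bellman P c g G v x) ∧
      ∀ (v' : C(X, ℝ)) (lam' : ℝ), (∀ x, v' x + lam' = bellman P c g G v' x) →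
        lam' = lam ∧ ∃ b : ℝ, ∀ x, v' x = v x + b := by
  obtain ⟨q, hq0, hq1, hq⟩ := exists_bellman_contraction hc hlo hg hG hlog hghi hhi hmix
  have hosc : ∀ (v : C(X, ℝ)) x y, bellman P c g G v x - bellman P c g G v y ≤ L := by
    intro v x y
    have := bellman_le_add_of_cost_le hc hg hG hghi hhi v (x := x) (y := y) (ε := L)
      fun k => by linarith [(hc x k).2, (hc y k).1]
    linarith
  have x₀ : X := Classical.arbitrary X
  have hL0 : 0 ≤ L := by simpa using hosc 0 x₀ x₀
  let T : C(X, ℝ) → C(X, ℝ) := fun v =>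
    ⟨fun x => bellman P c g G v x - bellman P c g G v x₀,
      (continuous_bellman hc hcc hg hG hghi hhi v).sub continuous_const⟩
  have hT : ∀ v x, T v x = bellman P c g G v x - bellman P c g G v x₀ := fun _ _ => rfl
  have hTosc : ∀ v x y, T v x - T v y ≤ L := fun v x y => by
    rw [hT, hT]; linarith [hosc v x y]
  have hTc : ∀ v₁ v₂ : C(X, ℝ), (∀ x y, v₁ x - v₁ y ≤ L) →
      (∀ x y, v₂ x - v₂ y ≤ L) → ∀ D, (∀ x y, (v₁ x - v₂ x) - (v₁ y - v₂ y) ≤ D) → ∀ x y,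
        (T v₁ x - T v₂ x) - (T v₁ y - T v₂ y) ≤ q * D := fun v₁ v₂ h₁ h₂ D hD x y => by
    simp only [hT]; linarith [hq v₁ v₂ h₁ h₂ D hD x y]
  have hT0 : ∀ v, T v x₀ = 0 := fun v => by rw [hT, sub_self]
  have hdist : ∀ v₁ v₂ : C(X, ℝ), v₁ x₀ = 0 → v₂ x₀ = 0 → ∀ D, 0 ≤ D →
      (∀ x y, (v₁ x - v₂ x) - (v₁ y - v₂ y) ≤ D) → dist v₁ v₂ ≤ D := by
    intro v₁ v₂ h₁ h₂ D hD h
    refine (ContinuousMap.dist_le hD).2 fun x => ?_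
    rw [Real.dist_eq, abs_le]
    have a1 := h x x₀
    have a2 := h x₀ x
    rw [h₁, h₂] at a1 a2
    constructor <;> linarith
  let V : ℕ → C(X, ℝ) := fun n => T^[n] 0
  have hVs : ∀ n, V (n + 1) = T (V n) := fun n => Function.iterate_succ_apply' T n 0
  have hV0 : ∀ n, V n x₀ = 0 := by
    intro n
    cases n with
    | zero => rfl
    | succ n => rw [hVs]; exact hT0 _
  have hVosc : ∀ n x y, V n x - V n y ≤ L := by
    intro n x y
    cases n with
    | zero => simpa [V] using hL0
    | succ n => rw [hVs]; exact hTosc _ _ _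
  have hVgeo : ∀ n x y, (V n x - V (n + 1) x) - (V n y - V (n + 1) y) ≤ (2 * L) * q ^ n := by
    intro n
    induction n with
    | zero =>
      intro x y
      have a1 := hVosc 0 x y
      have a2 := hVosc 1 y x
      simp only [zero_add, pow_zero]
      linarith
    | succ n ih =>
      intro x y
      rw [hVs (n + 1)]
      nth_rewrite 1 3 [hVs n]
      refine (hTc _ _ (hVosc n) (hVosc (n + 1)) _ ih x y).trans_eq ?_
      ring
  have hcau : CauchySeq V := cauchySeq_of_le_geometric q (2 * L) hq1 fun n =>
    hdist _ _ (hV0 n) (hV0 (n + 1)) _ (by positivity) (hVgeo n)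
  obtain ⟨v, hv⟩ := cauchySeq_tendsto_of_complete hcau
  have hvx : ∀ x, Filter.Tendsto (fun n => V n x) Filter.atTop (nhds (v x)) := fun x =>
    ((continuous_eval_const x).tendsto v).comp hv
  have hvosc : ∀ x y, v x - v y ≤ L := fun x y =>
    le_of_tendsto ((hvx x).sub (hvx y)) (Filter.Eventually.of_forall fun n => hVosc n x y)
  have hTv : Filter.Tendsto (fun n => V (n + 1)) Filter.atTop (nhds (T v)) := by
    rw [tendsto_iff_dist_tendsto_zero]
    have hz : Filter.Tendsto (fun n => q * (2 * dist (V n) v)) Filter.atTop (nhds 0) := by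
      simpa using ((tendsto_iff_dist_tendsto_zero.1 hv).const_mul 2).const_mul q
    refine squeeze_zero (fun _ => dist_nonneg) (fun n => ?_) hz
    rw [hVs]
    refine hdist _ _ (hT0 _) (hT0 _) _ (by positivity) (hTc _ _ (hVosc n) hvosc _ ?_)
    intro x y
    have a1 := ContinuousMap.dist_apply_le_dist (f := V n) (g := v) x
    have a2 := ContinuousMap.dist_apply_le_dist (f := V n) (g := v) y
    rw [Real.dist_eq] at a1 a2
    linarith [(abs_le.1 a1).2, (abs_le.1 a2).1]
  have hfix : T v = v := tendsto_nhds_unique hTv (hv.comp (Filter.tendsto_add_atTop_nat 1))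
  have hsol : ∀ x, v x + bellman P c g G v x₀ = bellman P c g G v x := fun x => by
    have := hT v x
    rw [hfix] at this
    linarith
  refine ⟨v, bellman P c g G v x₀, hsol, fun v' lam' h' => ?_⟩
  have hv'osc : ∀ x y, v' x - v' y ≤ L := fun x y => by linarith [hosc v' x y, h' x, h' y]
  obtain ⟨xM, -, hxM⟩ := isCompact_univ.exists_isMaxOn univ_nonempty
    (v' - v).continuous.continuousOn
  obtain ⟨xm, -, hxm⟩ := isCompact_univ.exists_isMinOn univ_nonempty
    (v' - v).continuous.continuousOn
  have hM : ∀ z, v' z - v z ≤ v' xM - v xM := fun z => hxM (mem_univ z)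
  have hm : ∀ z, v' xm - v xm ≤ v' z - v z := fun z => hxm (mem_univ z)
  have hcon := hq v' v hv'osc hvosc ((v' xM - v xM) - (v' xm - v xm))
    (fun x y => by linarith [hM x, hm y]) xM xm
  have hzero : (v' xM - v xM) - (v' xm - v xm) ≤ 0 := by
    nlinarith [h' xM, h' xm, hsol xM, hsol xm]
  have hconst : ∀ x, v' x = v x + (v' x₀ - v x₀) := fun x => by
    linarith [hM x, hm x, hM x₀, hm x₀]
  refine ⟨?_, _, hconst⟩
  have u1 := bellman_le_of_le_add hc hg hG hghi hhi (fun x => (hconst x).le) x₀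
  have u2 := bellman_le_of_le_add hc hg hG hghi hhi (v₁ := v) (v₂ := v')
    (M := -(v' x₀ - v x₀)) (fun x => by linarith [hconst x]) x₀
  linarith [h' x₀, hsol x₀]

end Bellman

section Simplex

variable {d : ℕ}

lemma ip_pos {x y : Fin d → ℝ} (hx : x ∈ stdSimplex ℝ (Fin d)) (hy : ∀ i, 0 < y i) :
    0 < ip x y := by
  refine Finset.sum_pos' (fun i _ => mul_nonneg (hx.1 i) (hy i).le) ?_
  by_contra! hcon
  have : ∑ i, x i ≤ 0 := Finset.sum_nonpos fun i hi =>
    nonpos_of_mul_nonpos_left (hcon i hi) (hy i)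
  linarith [hx.2]

lemma Gmap_mem_stdSimplex {x y : Fin d → ℝ} (hx : x ∈ stdSimplex ℝ (Fin d))
    (hy : ∀ i, 0 < y i) : Gmap x y ∈ stdSimplex ℝ (Fin d) := by
  refine ⟨fun i => div_nonneg (mul_nonneg (hx.1 i) (hy i).le) (ip_pos hx hy).le, ?_⟩
  simp only [Gmap]
  rw [← Finset.sum_div]
  exact div_self (ip_pos hx hy).ne'

lemma Sdel_nonempty (hd : 0 < d) {δ : ℝ} (hδ : δ < 1 / d) :
    (Sdel δ : Set (Fin d → ℝ)).Nonempty := by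
  have : (d : ℝ) ≠ 0 := by positivity
  refine ⟨fun _ => 1 / d, ⟨fun i => by positivity, ?_⟩, fun i => hδ.le⟩
  simp [this]

lemma measurable_ip_exp {Ω : Type*} [MeasurableSpace Ω] {r : Ω → Fin d → ℝ} (hr : Measurable r)
    (x : Fin d → ℝ) : Measurable fun ω => ip x fun i => Real.exp (r ω i) := by
  unfold ip
  exact Finset.measurable_sum _ fun i _ => ((measurable_pi_iff.1 hr i).exp).const_mul _

lemma measurable_Gmap_exp {Ω : Type*} [MeasurableSpace Ω] {r : Ω → Fin d → ℝ}
    (hr : Measurable r) (x : Fin d → ℝ) :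
    Measurable fun ω => Gmap x fun i => Real.exp (r ω i) := by
  refine measurable_pi_iff.2 fun i => ?_
  exact (((measurable_pi_iff.1 hr i).exp).const_mul _).div (measurable_ip_exp hr x)

/-- The capital-decay cost is continuous in the first argument, uniformly in the second. -/
lemma eventually_log_decay_close {st : ℝ} (hst : 0 < st) {s : (Fin d → ℝ) → (Fin d → ℝ) → ℝ}
    (hs : ∀ x ∈ stdSimplex ℝ (Fin d), ∀ y ∈ stdSimplex ℝ (Fin d), s x y ∈ Icc st 1)
    (hscont : ContinuousOn (fun p : (Fin d → ℝ) × (Fin d → ℝ) => s p.1 p.2)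
      (stdSimplex ℝ (Fin d) ×ˢ stdSimplex ℝ (Fin d))) (γ : ℝ) (x : stdSimplex ℝ (Fin d))
    {ε : ℝ} (hε : 0 < ε) :
    ∀ᶠ y : stdSimplex ℝ (Fin d) in nhds x, ∀ k : stdSimplex ℝ (Fin d),
      |γ * Real.log (s y k) - γ * Real.log (s x k)| < ε := by
  have hf : Continuous fun p : stdSimplex ℝ (Fin d) × stdSimplex ℝ (Fin d) =>
      γ * Real.log (s p.1 p.2) := by
    have h1 : Continuous fun p : stdSimplex ℝ (Fin d) × stdSimplex ℝ (Fin d) =>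
        s p.1 p.2 :=
      hscont.comp_continuous
        ((continuous_subtype_val.comp continuous_fst).prodMk
          (continuous_subtype_val.comp continuous_snd))
        fun p => ⟨p.1.2, p.2.2⟩
    exact continuous_const.mul
      (h1.log fun p => (hst.trans_le (hs _ p.1.2 _ p.2.2).1).ne')
  have hu := CompactSpace.uniformContinuous_of_continuous hf
  obtain ⟨η, hη, h⟩ := Metric.uniformContinuous_iff.1 hu ε hε
  filter_upwards [Metric.ball_mem_nhds x hη] with y hy k
  have := h (a := (y, k)) (b := (x, k)) (by
    rw [Prod.dist_eq, dist_self]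
    exact max_lt hy hη)
  rwa [Real.dist_eq] at this

end Simplex

/-- for `γ < 0`, under (A.1) and (A.2), for each `δ ∈ (0, 1/d)` there
exist a bounded continuous `v_δ : S → ℝ`, unique up to an additive constant, and a
constant `λ_δ ∈ ℝ` with `v_δ(π) + λ_δ = (T_δ v_δ)(π)` for every `π ∈ S`. -/
theorem restricted_bellman_solution_exists_unique {d : ℕ} (hd : 0 < d)
    {Ω : Type*} [MeasurableSpace Ω]
    (P : Measure Ω) [IsProbabilityMeasure P]
    (st : ℝ) (hst : st ∈ Ioo (0 : ℝ) 1)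
    (s : (Fin d → ℝ) → (Fin d → ℝ) → ℝ)
    (hs : ∀ x ∈ stdSimplex ℝ (Fin d), ∀ y ∈ stdSimplex ℝ (Fin d), s x y ∈ Icc st 1)
    (hscont : ContinuousOn (fun p : (Fin d → ℝ) × (Fin d → ℝ) => s p.1 p.2)
      (stdSimplex ℝ (Fin d) ×ˢ stdSimplex ℝ (Fin d)))
    (γ : ℝ) (hγ : γ < 0) (r : Ω → Fin d → ℝ) (hrm : Measurable r)
    (hA1exp : ∀ i, Integrable (fun ω => Real.exp (γ * r ω i)) P)
    (hA1int : ∀ i, Integrable (fun ω => r ω i) P)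
    (hA2 : ∀ δ ∈ Ioo (0 : ℝ) (1 / d), ∃ κ < (1 : ℝ),
      ∀ A : Set (Fin d → ℝ), MeasurableSet A →
        ∀ π ∈ Sdel δ, ∀ π' ∈ Sdel δ,
          (P {ω | Gmap π (fun i => Real.exp (r ω i)) ∈ A}).toReal -
            (P {ω | Gmap π' (fun i => Real.exp (r ω i)) ∈ A}).toReal ≤ κ)
    (δ : ℝ) (hδ : δ ∈ Ioo (0 : ℝ) (1 / d)) :
    ∃ (v : (Fin d → ℝ) → ℝ) (lam : ℝ),
      ContinuousOn v (stdSimplex ℝ (Fin d)) ∧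
      (∃ C : ℝ, ∀ π ∈ stdSimplex ℝ (Fin d), |v π| ≤ C) ∧
      (∀ π ∈ stdSimplex ℝ (Fin d), v π + lam = Tdel P γ s r δ v π) ∧
      ∀ (v' : (Fin d → ℝ) → ℝ) (lam' : ℝ),
        ContinuousOn v' (stdSimplex ℝ (Fin d)) →
        (∃ C : ℝ, ∀ π ∈ stdSimplex ℝ (Fin d), |v' π| ≤ C) →
        (∀ π ∈ stdSimplex ℝ (Fin d), v' π + lam' = Tdel P γ s r δ v' π) →
        lam' = lam ∧ ∃ c : ℝ, ∀ π ∈ stdSimplex ℝ (Fin d), v' π = v π + c := by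
  classical
  have hδ0 : 0 < δ := hδ.1
  have hw : ∀ ω i, 0 < Real.exp (r ω i) := fun ω i => Real.exp_pos _
  let i₀ : Fin d := ⟨0, hd⟩
  have : Nonempty (Fin d) := ⟨i₀⟩
  have : Nonempty (Sdel δ : Set (Fin d → ℝ)) := (Sdel_nonempty hd hδ.2).to_subtype
  have : Nonempty (stdSimplex ℝ (Fin d)) :=
    let ⟨p, hp⟩ := Sdel_nonempty hd hδ.2; ⟨⟨p, hp.1⟩⟩
  have : CompactSpace (stdSimplex ℝ (Fin d)) :=
    isCompact_iff_compactSpace.1 (isCompact_stdSimplex ℝ (Fin d))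
  let c : stdSimplex ℝ (Fin d) → Sdel (d := d) δ → ℝ := fun x k =>
    γ * Real.log (s x k)
  let g : Sdel (d := d) δ → Ω → ℝ := fun k ω =>
    γ * Real.log (ip k fun i => Real.exp (r ω i))
  let G : Sdel (d := d) δ → Ω → stdSimplex ℝ (Fin d) := fun k ω =>
    ⟨Gmap k fun i => Real.exp (r ω i), Gmap_mem_stdSimplex k.2.1 (hw ω)⟩
  let lo : Ω → ℝ := fun ω => γ * Real.log (∑ i, Real.exp (r ω i))
  let hi : Ω → ℝ := fun ω => γ * Real.log δ + γ * r ω i₀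
  have hkey : ∀ (v : (Fin d → ℝ) → ℝ) (V : C(stdSimplex ℝ (Fin d), ℝ)),
      (∀ x : stdSimplex ℝ (Fin d), v x = V x) →
      ∀ x : stdSimplex ℝ (Fin d), Tdel P γ s r δ v x = bellman P c g G V x := by
    intro v V hvV x
    unfold Tdel bellman certEquiv
    rw [sSup_image']
    refine iSup_congr fun k => ?_
    have : ∀ ω, v (Gmap k fun i => Real.exp (r ω i)) = V (G k ω) := fun ω => hvV (G k ω)
    simp only [this]
    rfl
  have hc : ∀ x k, c x k ∈ Icc 0 (γ * Real.log st) := by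
    intro x k
    have h := hs x x.2 k k.2.1
    have hpos : 0 < s x k := hst.1.trans_le h.1
    exact ⟨mul_nonneg_of_nonpos_of_nonpos hγ.le (Real.log_nonpos hpos.le h.2),
      mul_le_mul_of_nonpos_left (Real.log_le_log hst.1 h.1) hγ.le⟩
  have hcc : ∀ x, ∀ ε > 0, ∀ᶠ y in nhds x, ∀ k, |c y k - c x k| < ε := by
    intro x ε hε
    filter_upwards [eventually_log_decay_close hst.1 hs hscont γ x hε] with y hy k
    exact hy ⟨k, k.2.1⟩
  have hlo : Measurable lo :=
    ((Finset.measurable_sum _ fun i _ => (measurable_pi_iff.1 hrm i).exp).log).const_mul γ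
  have hg : ∀ k, Measurable (g k) := fun k => (measurable_ip_exp hrm k).log.const_mul γ
  have hG : ∀ k, Measurable (G k) := fun k => (measurable_Gmap_exp hrm k).subtype_mk
  have hlog : ∀ k ω, lo ω ≤ g k ω := by
    intro k ω
    refine mul_le_mul_of_nonpos_left (Real.log_le_log (ip_pos k.2.1 (hw ω)) ?_) hγ.le
    refine Finset.sum_le_sum fun i _ => mul_le_of_le_one_left (hw ω i).le ?_
    rw [← k.2.1.2]
    exact Finset.single_le_sum (fun j _ => k.2.1.1 j) (Finset.mem_univ i)
  have hghi : ∀ k ω, g k ω ≤ hi ω := by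
    intro k ω
    have h1 : δ * Real.exp (r ω i₀) ≤ ip k fun i => Real.exp (r ω i) :=
      (mul_le_mul_of_nonneg_right (k.2.2 i₀) (hw ω i₀).le).trans
        (Finset.single_le_sum (f := fun i => (k : Fin d → ℝ) i * Real.exp (r ω i))
          (fun j _ => mul_nonneg (k.2.1.1 j) (hw ω j).le) (Finset.mem_univ i₀))
    have h2 := Real.log_le_log (mul_pos hδ0 (hw ω i₀)) h1
    rw [Real.log_mul hδ0.ne' (hw ω i₀).ne', Real.log_exp] at h2
    have h3 := mul_le_mul_of_nonpos_left h2 hγ.le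
    change γ * _ ≤ γ * Real.log δ + γ * r ω i₀
    linarith
  have hhi : Integrable (fun ω => Real.exp (hi ω)) P := by
    simp only [hi, Real.exp_add]
    exact (hA1exp i₀).const_mul _
  have hmix : ∃ κ < (1 : ℝ), ∀ A : Set (stdSimplex ℝ (Fin d)), MeasurableSet A → ∀ k k',
      P.real (G k ⁻¹' A) - P.real (G k' ⁻¹' A) ≤ κ := by
    obtain ⟨κ, hκ, h⟩ := hA2 δ hδ
    refine ⟨κ, hκ, fun A hA k k' => ?_⟩
    have hS : MeasurableSet (stdSimplex ℝ (Fin d)) := (isClosed_stdSimplex ℝ (Fin d)).measurableSet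
    have := h (Subtype.val '' A) (hS.subtype_image hA) k k.2 k' k'.2
    have he : ∀ k, {ω | Gmap (k : Sdel δ).1 (fun i => Real.exp (r ω i)) ∈ Subtype.val '' A} =
        G k ⁻¹' A := by
      intro k
      ext ω
      exact Subtype.val_injective.mem_set_image (a := G k ω)
    rwa [he, he] at this
  obtain ⟨V, lam, hV, huniq⟩ :=
    bellman_solution_exists_unique hc hcc hlo hg hG hlog hghi hhi hmix
  let v : (Fin d → ℝ) → ℝ := fun p => if h : p ∈ stdSimplex ℝ (Fin d) then V ⟨p, h⟩ else 0
  have hv : ∀ x : stdSimplex ℝ (Fin d), v x = V x := fun x => dif_pos x.2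
  have hvS : ∀ π (hπ : π ∈ stdSimplex ℝ (Fin d)), v π = V ⟨π, hπ⟩ := fun _ hπ => dif_pos hπ
  refine ⟨v, lam, ?_, ⟨‖V‖, fun π hπ => ?_⟩, fun π hπ => ?_, ?_⟩
  · rw [continuousOn_iff_continuous_domRestrict]
    exact V.continuous.congr fun x => (hv x).symm
  · rw [hvS π hπ]
    exact V.norm_coe_le_norm _
  · rw [hvS π hπ, hV]
    exact (hkey v V hv ⟨π, hπ⟩).symm
  · intro v' lam' hv'c _ hv'
    let V' : C(stdSimplex ℝ (Fin d), ℝ) := ⟨fun x => v' x, hv'c.domRestrict⟩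
    obtain ⟨h1, b, hb⟩ := huniq V' lam' fun x => by
      rw [← hkey v' V' (fun _ => rfl) x]
      exact hv' x x.2
    exact ⟨h1, b, fun π hπ => by rw [hvS π hπ]; exact hb ⟨π, hπ⟩⟩
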